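/- (Flat forms pull back to gauge-equivalent forms along homotopic maps; 1-form case.) Let A be a real unital Banach algebra, V ⊆ ℝⁿ open, and ω : V → Fin n → A a smooth family of components satisfying ∂_i ω_j − ∂_j ω_i + ω_i ω_j − ω_j ω_i = 0 on V for all i, j. Let F : ℝ^m × ℝ → ℝⁿ be smooth with F(x,t) ∈ V for all x ∈ ℝ^m, t ∈ [0,1], and set f₀ = F(·,0), f₁ = F(·,1). Define the pullback components (f*ω)_i(x) = Σ_j ∂_i f_j(x) · ω_j(f(x)) for a smooth map f : ℝ^m → V. Then there exists a smooth map g : ℝ^m → A, with g(x) invertible for all x, such that (f₁*ω)_i(x) = g(x)·(f₀*ω)_i(x)·g(x)⁻¹ − ∂_i g(x)·g(x)⁻¹ for all i and all x ∈ ℝ^m. -/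

import Mathlib

section FlatConnections

open Set Filter Topology Metric
open scoped NNReal

/-- The radial retraction of a normed space onto the closed ball of radius `R` is
`2`-Lipschitz. -/
lemma lipschitzWith_two_radialRetraction {E : Type*} [NormedAddCommGroup E] [NormedSpace ℝ E]
    {R : ℝ} (hR : 0 < R) : LipschitzWith 2 fun y : E => (R / max R ‖y‖) • y := by
  refine LipschitzWith.of_dist_le_mul fun x y => ?_
  rw [dist_eq_norm, dist_eq_norm]
  have hx : 0 < max R ‖x‖ := lt_max_of_lt_left hR
  have hy : 0 < max R ‖y‖ := lt_max_of_lt_left hR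
  have hsplit : (R / max R ‖x‖) • x - (R / max R ‖y‖) • y
      = (R / max R ‖x‖) • (x - y) + (R / max R ‖x‖ - R / max R ‖y‖) • y := by module
  have h1 : R / max R ‖x‖ ≤ 1 := (div_le_one hx).2 (le_max_left _ _)
  have h1' : 0 ≤ R / max R ‖x‖ := by positivity
  have h2 : R / max R ‖x‖ - R / max R ‖y‖
      = R / max R ‖x‖ * ((max R ‖y‖ - max R ‖x‖) / max R ‖y‖) := by
    field_simp
  have h3 : |max R ‖y‖ - max R ‖x‖| ≤ ‖x - y‖ := by
    rw [max_comm R, max_comm R]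
    refine (abs_max_sub_max_le_abs _ _ _).trans ?_
    rw [norm_sub_rev]
    exact abs_norm_sub_norm_le _ _
  have h4 : ‖y‖ / max R ‖y‖ ≤ 1 := (div_le_one hy).2 (le_max_right _ _)
  calc ‖(R / max R ‖x‖) • x - (R / max R ‖y‖) • y‖
      ≤ ‖(R / max R ‖x‖) • (x - y)‖ + ‖(R / max R ‖x‖ - R / max R ‖y‖) • y‖ := by
        rw [hsplit]; exact norm_add_le _ _
    _ = R / max R ‖x‖ * ‖x - y‖
          + R / max R ‖x‖ * (|max R ‖y‖ - max R ‖x‖| * (‖y‖ / max R ‖y‖)) := by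
        rw [norm_smul, norm_smul, h2, Real.norm_of_nonneg h1', norm_mul,
          Real.norm_of_nonneg h1', norm_div, Real.norm_of_nonneg hy.le, Real.norm_eq_abs]
        ring
    _ ≤ 1 * ‖x - y‖ + 1 * (‖x - y‖ * 1) := by gcongr
    _ = ((2 : ℝ≥0) : ℝ) * ‖x - y‖ := by push_cast; ring

lemma HasDerivWithinAt.Ici_of_Icc {E : Type*} [NormedAddCommGroup E] [NormedSpace ℝ E]
    {f : ℝ → E} {f' : E} {a b t : ℝ} (h : HasDerivWithinAt f f' (Icc a b) t)
    (ht : t ∈ Ico a b) : HasDerivWithinAt f f' (Ici t) t :=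
  h.mono_of_mem_nhdsWithin (Icc_mem_nhdsGE_of_mem ht)

/-- A linear ODE with continuous coefficients on `[0, 1]` has a solution on all of `[0, 1]`. -/
lemma exists_linear_ode_solution {E : Type*} [NormedAddCommGroup E] [NormedSpace ℝ E]
    [CompleteSpace E] {c : ℝ → E →L[ℝ] E} (hc : ContinuousOn c (Icc 0 1)) (y₀ : E) :
    ∃ y : ℝ → E, y 0 = y₀ ∧
      ∀ t ∈ Icc (0 : ℝ) 1, HasDerivWithinAt y (c t (y t)) (Icc 0 1) t := by
  obtain ⟨C, hC⟩ := isCompact_Icc.exists_bound_of_continuousOn hc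
  obtain ⟨K, hcK⟩ : ∃ K : ℝ≥0, ∀ t ∈ Icc (0 : ℝ) 1, ‖c t‖ ≤ K :=
    ⟨C.toNNReal, fun t ht => (hC t ht).trans (Real.le_coe_toNNReal C)⟩
  obtain ⟨R, hRR⟩ : ∃ R : ℝ≥0, (R : ℝ) = (‖y₀‖ + 1) * Real.exp K :=
    ⟨_, Real.coe_toNNReal _ (by positivity)⟩
  have hR : (0 : ℝ) < R := by rw [hRR]; positivity
  set ρ : E → E := fun y => ((R : ℝ) / max (R : ℝ) ‖y‖) • y with hρ
  have hρR : ∀ y, ‖ρ y‖ ≤ R := by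
    intro y
    have hy : 0 < max (R : ℝ) ‖y‖ := lt_max_of_lt_left hR
    rw [hρ, norm_smul, Real.norm_of_nonneg (by positivity), div_mul_eq_mul_div, div_le_iff₀ hy]
    gcongr
    exact le_max_right _ _
  have hρle : ∀ y, ‖ρ y‖ ≤ ‖y‖ := by
    intro y
    have hy : 0 < max (R : ℝ) ‖y‖ := lt_max_of_lt_left hR
    rw [hρ, norm_smul, Real.norm_of_nonneg (by positivity)]
    exact mul_le_of_le_one_left (norm_nonneg _) ((div_le_one hy).2 (le_max_left _ _))
  have hPL : IsPicardLindelof (fun t y => c t (ρ y)) (tmin := 0) (tmax := 1)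
      ⟨0, by simp⟩ y₀ (K * R) 0 (K * R) (K * 2) := by
    refine ⟨fun t ht => ?_, fun x _ => hc.clm_apply continuousOn_const, fun t ht x _ => ?_, ?_⟩
    · have h1 : LipschitzWith K (c t) :=
        (c t).lipschitz.weaken (by rw [← NNReal.coe_le_coe]; exact hcK t ht)
      exact (h1.comp (lipschitzWith_two_radialRetraction hR)).lipschitzOnWith
    · rw [NNReal.coe_mul]
      exact (c t).le_of_opNorm_le_of_le (hcK t ht) (hρR x)
    · simp
  obtain ⟨y, hy0, hy⟩ := hPL.exists_eq_forall_mem_Icc_hasDerivWithinAt₀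
  refine ⟨y, hy0, fun t ht => ?_⟩
  have hbound := norm_le_gronwallBound_of_norm_deriv_right_le (δ := ‖y₀‖) (K := K) (ε := 0)
    (fun t ht => (hy t ht).continuousWithinAt)
    (fun t ht => (hy t (Ico_subset_Icc_self ht)).Ici_of_Icc ht) (by simp [← hy0])
    (fun t ht => by
      rw [add_zero]
      exact (c t).le_of_opNorm_le_of_le (hcK t (Ico_subset_Icc_self ht)) (hρle _)) t ht
  have hyR : ‖y t‖ ≤ R := by
    refine hbound.trans ?_
    rw [gronwallBound_ε0, hRR, sub_zero]
    have := ht.2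
    have hK0 : (0 : ℝ) ≤ K := K.2
    gcongr
    · linarith
    · nlinarith
  have hfix : ρ (y t) = y t := by simp [hρ, max_eq_left hyR, hR.ne']
  simpa only [hfix] using hy t ht

/-- Uniqueness for linear ODEs on `[0, 1]`, with the zero initial value. -/
lemma linear_ode_eq_zero {E : Type*} [NormedAddCommGroup E] [NormedSpace ℝ E]
    {c : ℝ → E →L[ℝ] E} (hc : ContinuousOn c (Icc 0 1)) {y : ℝ → E} (hy0 : y 0 = 0)
    (hy : ∀ t ∈ Icc (0 : ℝ) 1, HasDerivWithinAt y (c t (y t)) (Icc 0 1) t) :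
    ∀ t ∈ Icc (0 : ℝ) 1, y t = 0 := by
  obtain ⟨C, hC⟩ := isCompact_Icc.exists_bound_of_continuousOn hc
  exact eq_zero_of_abs_deriv_le_mul_abs_self_of_eq_zero_right
    (fun t ht => (hy t ht).continuousWithinAt)
    (fun t ht => (hy t (Ico_subset_Icc_self ht)).Ici_of_Icc ht) hy0
    fun t ht => (c t).le_of_opNorm_le (hC t (Ico_subset_Icc_self ht)) _

/-- The solution of `y' = -a y`, `y 0 = 1` in a Banach algebra is invertible on `[0, 1]`. -/
lemma isUnit_of_linear_ode {A : Type*} [NormedRing A] [NormedAlgebra ℝ A] [CompleteSpace A]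
    {a y : ℝ → A} (ha : ContinuousOn a (Icc 0 1)) (hy0 : y 0 = 1)
    (hy : ∀ t ∈ Icc (0 : ℝ) 1, HasDerivWithinAt y (-(a t * y t)) (Icc 0 1) t) :
    ∀ t ∈ Icc (0 : ℝ) 1, IsUnit (y t) := by
  have hl : ContinuousOn (fun t => ContinuousLinearMap.mul ℝ A (a t)) (Icc 0 1) :=
    (ContinuousLinearMap.mul ℝ A).continuous.comp_continuousOn ha
  have hr : ContinuousOn (fun t => (ContinuousLinearMap.mul ℝ A).flip (a t)) (Icc 0 1) :=
    (ContinuousLinearMap.mul ℝ A).flip.continuous.comp_continuousOn ha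
  obtain ⟨z, hz0, hz⟩ := exists_linear_ode_solution hr 1
  simp only [ContinuousLinearMap.flip_apply, ContinuousLinearMap.mul_apply'] at hz
  have hzy : ∀ t ∈ Icc (0 : ℝ) 1, z t * y t - 1 = 0 :=
    linear_ode_eq_zero (c := fun _ => (0 : A →L[ℝ] A)) continuousOn_const (by simp [hz0, hy0]) fun t ht => by
      refine (((hz t ht).mul (hy t ht)).sub_const 1).congr_deriv ?_
      rw [zero_apply, mul_neg, mul_assoc, add_neg_cancel]
  have hyz : ∀ t ∈ Icc (0 : ℝ) 1, y t * z t - 1 = 0 :=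
    linear_ode_eq_zero (c := fun t => (ContinuousLinearMap.mul ℝ A).flip (a t)
      - ContinuousLinearMap.mul ℝ A (a t)) (hr.sub hl) (by simp [hz0, hy0]) fun t ht => by
      refine (((hy t ht).mul (hz t ht)).sub_const 1).congr_deriv ?_
      change _ = (y t * z t - 1) * a t - a t * (y t * z t - 1)
      noncomm_ring
  exact fun t ht => ⟨⟨y t, z t, sub_eq_zero.1 (hyz t ht), sub_eq_zero.1 (hzy t ht)⟩, rfl⟩

section Transport

variable {E : Type*} [NormedAddCommGroup E] [NormedSpace ℝ E]

/-- A `C¹` function of `(x, t)` is differentiable in `x` uniformly in `t ∈ [0, 1]`. -/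
lemma eventually_forall_norm_sub_fderiv_le {G : Type*} [NormedAddCommGroup G] [NormedSpace ℝ G]
    {f : E × ℝ → G} (hf : ∀ p : E × ℝ, p.2 ∈ Icc (0 : ℝ) 1 → ContDiffAt ℝ 1 f p) (x : E)
    {η : ℝ} (hη : 0 < η) :
    ∀ᶠ x' in 𝓝 x, ∀ t ∈ Icc (0 : ℝ) 1,
      ‖f (x', t) - f (x, t) - fderiv ℝ f (x, t) (x' - x, 0)‖ ≤ η * ‖x' - x‖ := by
  refine isCompact_Icc.eventually_forall_of_forall_eventually fun t ht => ?_
  have hd := hf (x, t) ht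
  have hstrict := (hd.hasStrictFDerivAt one_ne_zero).isLittleO.def (half_pos hη)
  have hcont : ContinuousAt (fderiv ℝ f) (x, t) := hd.continuousAt_fderiv one_ne_zero
  have htend : Tendsto (fun z : E × ℝ => (z, (x, z.2))) (𝓝 (x, t)) (𝓝 ((x, t), (x, t))) :=
    Continuous.tendsto' (by fun_prop) _ _ rfl
  have htend' : Tendsto (fun z : E × ℝ => (x, z.2)) (𝓝 (x, t)) (𝓝 (x, t)) :=
    Continuous.tendsto' (by fun_prop) _ _ rfl
  filter_upwards [htend.eventually hstrict,
    (hcont.tendsto.comp htend').eventually (closedBall_mem_nhds _ (half_pos hη))]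
    with z hz1 hz2
  replace hz2 : ‖fderiv ℝ f (x, t) - fderiv ℝ f (x, z.2)‖ ≤ η / 2 := by
    rw [norm_sub_rev, ← dist_eq_norm]; exact hz2
  have hsub : z - (x, z.2) = (z.1 - x, 0) := by ext <;> simp
  have hnorm : ‖((z.1 - x, 0) : E × ℝ)‖ = ‖z.1 - x‖ := by simp [Prod.norm_def]
  simp only [hsub, hnorm] at hz1
  have h3 := (fderiv ℝ f (x, t) - fderiv ℝ f (x, z.2)).le_of_opNorm_le hz2 (z.1 - x, 0)
  rw [hnorm] at h3
  calc _ = ‖(f z - f (x, z.2) - fderiv ℝ f (x, t) (z.1 - x, 0))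
        + (fderiv ℝ f (x, t) - fderiv ℝ f (x, z.2)) (z.1 - x, 0)‖ := by
        congr 1; rw [sub_apply]; abel
    _ ≤ η / 2 * ‖z.1 - x‖ + η / 2 * ‖z.1 - x‖ := norm_add_le_of_le hz1 h3
    _ = η * ‖z.1 - x‖ := by ring

variable {A : Type*} [NormedRing A] [NormedAlgebra ℝ A]

/-- The parallel transport of a flat connection form `α` along `t ↦ (x, t)`, `t ∈ [0, 1]`, is
differentiable in `x`, with the derivative dictated by flatness. -/
lemma hasFDerivAt_transport {α : E × ℝ → E × ℝ →L[ℝ] A}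
    (hα : ∀ p : E × ℝ, p.2 ∈ Icc (0 : ℝ) 1 → ContDiffAt ℝ 1 α p)
    (hflat : ∀ p : E × ℝ, p.2 ∈ Icc (0 : ℝ) 1 → ∀ u v,
      fderiv ℝ α p u v - fderiv ℝ α p v u + α p u * α p v - α p v * α p u = 0)
    {γ : E → ℝ → A} (hγ0 : ∀ x, γ x 0 = 1)
    (hγ : ∀ x, ∀ t ∈ Icc (0 : ℝ) 1,
      HasDerivWithinAt (γ x) (-(α (x, t) (0, 1) * γ x t)) (Icc 0 1) t) (x : E) :
    HasFDerivAt (fun y => γ y 1)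
      (((ContinuousLinearMap.mul ℝ A (γ x 1)).comp (α (x, 0))
        - ((ContinuousLinearMap.mul ℝ A).flip (γ x 1)).comp (α (x, 1))).comp
          (ContinuousLinearMap.inl ℝ E ℝ)) x := by
  have hαc : ContinuousOn (fun t : ℝ => α (x, t)) (Icc 0 1) := fun t ht =>
    ((hα (x, t) ht).continuousAt.comp (f := fun t : ℝ => (x, t))
      (by fun_prop)).continuousWithinAt
  have hγc : ContinuousOn (γ x) (Icc 0 1) := fun t ht => (hγ x t ht).continuousWithinAt
  obtain ⟨B, hB⟩ := isCompact_Icc.exists_bound_of_continuousOn hαc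
  obtain ⟨G, hG⟩ := isCompact_Icc.exists_bound_of_continuousOn hγc
  have hmem0 : (0 : ℝ) ∈ Icc (0 : ℝ) 1 := by simp
  have hmem1 : (1 : ℝ) ∈ Icc (0 : ℝ) 1 := by simp
  have hB0 : 0 ≤ B := (norm_nonneg _).trans (hB 0 hmem0)
  have hG0 : 0 ≤ G := (norm_nonneg _).trans (hG 0 hmem0)
  set K : ℝ := B + 1 with hK
  have hKpos : 0 < K := by positivity
  set N : ℝ := (Real.exp K - 1) / K with hN
  have hN0 : 0 ≤ N := div_nonneg (by linarith [Real.add_one_le_exp K]) hKpos.le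
  refine .of_isLittleO (Asymptotics.isLittleO_iff.2 fun c hc => ?_)
  set D : ℝ := (G + 2 * G * B + 1) * (N + 1) with hD
  have hDpos : 0 < D := by positivity
  have hη : 0 < c / D := div_pos hc hDpos
  have hη1 : 0 < min (c / D) 1 := lt_min hη one_pos
  have hunif : ∀ᶠ x' in 𝓝 x, ∀ t ∈ Icc (0 : ℝ) 1,
      ‖α (x', t) - α (x, t)‖ ≤ min (c / D) 1 := by
    refine isCompact_Icc.eventually_forall_of_forall_eventually fun t ht => ?_
    have h1 : ContinuousAt α (x, t) := (hα (x, t) ht).continuousAt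
    have h2 : ContinuousAt (fun z : E × ℝ => α (x, z.2)) (x, t) :=
      ContinuousAt.comp (f := fun z : E × ℝ => (x, z.2)) (g := α) h1 (by fun_prop)
    have h3 : ContinuousAt (fun z : E × ℝ => ‖α z - α (x, z.2)‖) (x, t) := (h1.sub h2).norm
    exact h3.eventually_le_const (by simpa using hη)
  filter_upwards [eventually_forall_norm_sub_fderiv_le hα x hη, hunif] with x' hx1 hx2
  set h := x' - x
  have hnorm : ‖((h, 0) : E × ℝ)‖ = ‖h‖ := by simp [Prod.norm_def]
  have hnorm1 : ‖((0, 1) : E × ℝ)‖ = 1 := by simp [Prod.norm_def]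
  set ℓ : ℝ → A := fun t => γ x t * α (x, 0) (h, 0) - α (x, t) (h, 0) * γ x t with hℓ
  have hℓbound : ∀ t ∈ Icc (0 : ℝ) 1, ‖ℓ t‖ ≤ 2 * G * B * ‖h‖ := by
    intro t ht
    have h1 := (α (x, 0)).le_of_opNorm_le (hB 0 hmem0) (h, 0)
    have h2 := (α (x, t)).le_of_opNorm_le (hB t ht) (h, 0)
    rw [hnorm] at h1 h2
    calc ‖ℓ t‖ ≤ ‖γ x t‖ * ‖α (x, 0) (h, 0)‖ + ‖α (x, t) (h, 0)‖ * ‖γ x t‖ :=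
          norm_sub_le_of_le (norm_mul_le _ _) (norm_mul_le _ _)
      _ ≤ G * (B * ‖h‖) + B * ‖h‖ * G := by gcongr <;> exact hG t ht
      _ = _ := by ring
  set e : ℝ → A := fun t => γ x' t - γ x t - ℓ t with he
  set e' : ℝ → A := fun t => -(α (x', t) (0, 1) * e t)
    - (α (x', t) - α (x, t) - fderiv ℝ α (x, t) (h, 0)) (0, 1) * γ x t
    - (α (x', t) - α (x, t)) (0, 1) * ℓ t with he'
  have hderiv : ∀ t ∈ Icc (0 : ℝ) 1, HasDerivWithinAt e (e' t) (Icc 0 1) t := by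
    intro t ht
    have hαt : HasDerivWithinAt (fun s : ℝ => α (x, s) (h, 0))
        (fderiv ℝ α (x, t) (0, 1) (h, 0)) (Icc 0 1) t := by
      have hd : HasDerivAt (fun s : ℝ => (x, s)) ((0, 1) : E × ℝ) t :=
        (hasDerivAt_const t x).prodMk (hasDerivAt_id t)
      have hc := ((hα (x, t) ht).differentiableAt one_ne_zero).hasFDerivAt.comp_hasDerivAt t hd
      have := hc.clm_apply (hasDerivAt_const t ((h, 0) : E × ℝ))
      simpa using this.hasDerivWithinAt
    have hℓ' := ((hγ x t ht).mul_const (α (x, 0) (h, 0))).sub (hαt.mul (hγ x t ht))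
    refine (((hγ x' t ht).sub (hγ x t ht)).sub hℓ').congr_deriv ?_
    have hfl := hflat (x, t) ht (0, 1) (h, 0)
    have hfl' : fderiv ℝ α (x, t) (0, 1) (h, 0) = fderiv ℝ α (x, t) (h, 0) (0, 1)
        - α (x, t) (0, 1) * α (x, t) (h, 0) + α (x, t) (h, 0) * α (x, t) (0, 1) := by
      rw [← sub_eq_zero, ← hfl]; abel
    simp only [he', he, hℓ, hfl', sub_apply]
    noncomm_ring
  have hbound : ∀ t ∈ Ico (0 : ℝ) 1,
      ‖e' t‖ ≤ K * ‖e t‖ + c / D * (G + 2 * G * B) * ‖h‖ := by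
    intro t ht'
    have ht := Ico_subset_Icc_self ht'
    have h1 : ‖α (x', t)‖ ≤ K := by
      have := norm_add_le_of_le ((hx2 t ht).trans (min_le_right _ _)) (hB t ht)
      rw [sub_add_cancel] at this
      linarith
    have h1' := (α (x', t)).le_of_opNorm_le h1 (0, 1)
    have h2 := ContinuousLinearMap.le_of_opNorm_le _ (hx1 t ht) (0, 1)
    have h3 := ContinuousLinearMap.le_of_opNorm_le _ ((hx2 t ht).trans (min_le_left _ _)) (0, 1)
    rw [hnorm1, mul_one] at h1' h2 h3
    calc ‖e' t‖ ≤ K * ‖e t‖ + c / D * ‖h‖ * G + c / D * (2 * G * B * ‖h‖) := by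
          refine norm_sub_le_of_le (norm_sub_le_of_le ?_ ?_) ?_
          · rw [norm_neg]
            exact (norm_mul_le _ _).trans (by gcongr)
          · exact (norm_mul_le _ _).trans (by gcongr; exact hG t ht)
          · exact (norm_mul_le _ _).trans (by gcongr; exact hℓbound t ht)
      _ = _ := by ring
  have hgron := norm_le_gronwallBound_of_norm_deriv_right_le (δ := 0)
    (fun t ht => (hderiv t ht).continuousWithinAt)
    (fun t ht => (hderiv t (Ico_subset_Icc_self ht)).Ici_of_Icc ht)
    (by simp [he, hℓ, hγ0]) hbound 1 hmem1
  rw [gronwallBound_of_K_ne_0 hKpos.ne'] at hgron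
  calc _ = ‖e 1‖ := rfl
    _ ≤ c / D * ((G + 2 * G * B) * N) * ‖h‖ := by
        refine hgron.trans (le_of_eq ?_)
        rw [hN]
        ring_nf
    _ ≤ c / D * D * ‖h‖ := by
        have : (G + 2 * G * B) * N ≤ D := by
          rw [hD]; exact mul_le_mul (by linarith) (by linarith) hN0 (by positivity)
        gcongr
    _ = c * ‖h‖ := by rw [div_mul_cancel₀ _ hDpos.ne']

/-- A flat connection form on `E × [0, 1]` restricts to gauge equivalent forms on the two ends. -/
lemma exists_gauge_of_flat [CompleteSpace A] {α : E × ℝ → E × ℝ →L[ℝ] A}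
    (hα : ∀ p : E × ℝ, p.2 ∈ Icc (0 : ℝ) 1 → ContDiffAt ℝ (⊤ : ℕ∞) α p)
    (hflat : ∀ p : E × ℝ, p.2 ∈ Icc (0 : ℝ) 1 → ∀ u v,
      fderiv ℝ α p u v - fderiv ℝ α p v u + α p u * α p v - α p v * α p u = 0) :
    ∃ g : E → A, ContDiff ℝ (⊤ : ℕ∞) g ∧ (∀ x, IsUnit (g x)) ∧
      ∀ x v, fderiv ℝ g x v = g x * α (x, 0) (v, 0) - α (x, 1) (v, 0) * g x := by
  have hmem0 : (0 : ℝ) ∈ Icc (0 : ℝ) 1 := by simp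
  have hmem1 : (1 : ℝ) ∈ Icc (0 : ℝ) 1 := by simp
  have hac : ∀ x : E, ContinuousOn (fun t : ℝ => α (x, t) (0, 1)) (Icc 0 1) := fun x t ht =>
    (((hα (x, t) ht).continuousAt.comp (f := fun t : ℝ => (x, t))
      (by fun_prop)).clm_apply continuousAt_const).continuousWithinAt
  have hex : ∀ x : E, ∃ y : ℝ → A, y 0 = 1 ∧ ∀ t ∈ Icc (0 : ℝ) 1,
      HasDerivWithinAt y (-(α (x, t) (0, 1) * y t)) (Icc 0 1) t := fun x =>
    exists_linear_ode_solution (c := fun t => -ContinuousLinearMap.mul ℝ A (α (x, t) (0, 1)))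
      ((ContinuousLinearMap.mul ℝ A).continuous.comp_continuousOn (hac x)).neg 1
  choose γ hγ0 hγ using hex
  have hderiv := hasFDerivAt_transport
    (fun p hp => (hα p hp).of_le (by exact_mod_cast le_top)) hflat hγ0 hγ
  have hend : ∀ t ∈ Icc (0 : ℝ) 1, ContDiff ℝ (⊤ : ℕ∞) fun x : E => α (x, t) := fun t ht =>
    contDiff_iff_contDiffAt.2 fun x =>
      ContDiffAt.comp x (hα (x, t) ht) (contDiff_prodMk_left t).contDiffAt
  refine ⟨fun x => γ x 1, contDiff_infty.2 fun k => ?_,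
    fun x => isUnit_of_linear_ode (hac x) (hγ0 x) (hγ x) 1 hmem1, fun x v => ?_⟩
  · induction k with
    | zero =>
      exact contDiff_zero.2 (continuous_iff_continuousAt.2 fun x => (hderiv x).continuousAt)
    | succ k ih =>
      push_cast
      refine contDiff_succ_iff_fderiv.2 ⟨fun x => (hderiv x).differentiableAt, by simp, ?_⟩
      rw [funext fun x => (hderiv x).fderiv]
      have hk : (k : WithTop ℕ∞) ≤ (⊤ : ℕ∞) := by exact_mod_cast le_top
      have h0 := (hend 0 hmem0).of_le hk
      have h1 := (hend 1 hmem1).of_le hk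
      exact ((((ContinuousLinearMap.mul ℝ A).contDiff.comp ih).clm_comp h0).sub
        (((ContinuousLinearMap.mul ℝ A).flip.contDiff.comp ih).clm_comp h1)).clm_comp
          contDiff_const
  · rw [(hderiv x).fderiv]
    simp

end Transport

section Pullback

variable {E X A : Type*} [NormedAddCommGroup E] [NormedSpace ℝ E] [NormedAddCommGroup X]
  [NormedSpace ℝ X] [NormedRing A] [NormedAlgebra ℝ A]

/-- Flatness is preserved by pullback. -/
lemma flat_pullback {W : X → X →L[ℝ] A} {F : E → X} {p : E} (hW : DifferentiableAt ℝ W (F p))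
    (hF : ContDiffAt ℝ 2 F p)
    (hflat : ∀ u v, fderiv ℝ W (F p) u v - fderiv ℝ W (F p) v u
      + W (F p) u * W (F p) v - W (F p) v * W (F p) u = 0) (u v : E) :
    fderiv ℝ (fun q => (W (F q)).comp (fderiv ℝ F q)) p u v
      - fderiv ℝ (fun q => (W (F q)).comp (fderiv ℝ F q)) p v u
      + (W (F p)).comp (fderiv ℝ F p) u * (W (F p)).comp (fderiv ℝ F p) v
      - (W (F p)).comp (fderiv ℝ F p) v * (W (F p)).comp (fderiv ℝ F p) u = 0 := by
  have hsymm : fderiv ℝ (fderiv ℝ F) p u v = fderiv ℝ (fderiv ℝ F) p v u :=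
    hF.isSymmSndFDerivAt (by simp) u v
  have hF1 : DifferentiableAt ℝ F p := hF.differentiableAt two_ne_zero
  have hF2 : DifferentiableAt ℝ (fderiv ℝ F) p :=
    (hF.fderiv_right (m := 1) (by norm_num)).differentiableAt one_ne_zero
  have hd := (hW.hasFDerivAt.comp p hF1.hasFDerivAt).clm_comp hF2.hasFDerivAt
  have hfl := hflat (fderiv ℝ F p u) (fderiv ℝ F p v)
  rw [show fderiv ℝ (fun q => (W (F q)).comp (fderiv ℝ F q)) p = _ from hd.fderiv, ← hfl]
  simp [hsymm]

end Pullback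

/-- The `1`-form with components `ω`, as a map into continuous linear maps. -/
noncomputable def formOfComponents {A : Type*} [NormedRing A] [NormedAlgebra ℝ A] {n : ℕ}
    (ω : (Fin n → ℝ) → Fin n → A) (y : Fin n → ℝ) : (Fin n → ℝ) →L[ℝ] A :=
  ∑ j, (ContinuousLinearMap.proj (R := ℝ) (φ := fun _ : Fin n => ℝ) j).smulRight (ω y j)

section Components

variable {A : Type*} [NormedRing A] [NormedAlgebra ℝ A] {n : ℕ}
  {ω : (Fin n → ℝ) → Fin n → A} {y : Fin n → ℝ}

lemma formOfComponents_apply (u : Fin n → ℝ) :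
    formOfComponents ω y u = ∑ j, u j • ω y j := by
  simp [formOfComponents]

lemma contDiffAt_formOfComponents {k : WithTop ℕ∞} (hω : ContDiffAt ℝ k ω y) :
    ContDiffAt ℝ k (formOfComponents ω) y :=
  ContDiffAt.sum fun j _ => contDiffAt_const.smulRight (contDiffAt_pi.1 hω j)

lemma fderiv_formOfComponents (hω : DifferentiableAt ℝ ω y) (u v : Fin n → ℝ) :
    fderiv ℝ (formOfComponents ω) y u v
      = ∑ i, ∑ j, (u i * v j) • fderiv ℝ (fun z => ω z j) y (Pi.single i 1) := by
  have hW : DifferentiableAt ℝ (formOfComponents ω) y :=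
    DifferentiableAt.fun_sum fun j _ =>
      (ContinuousLinearMap.smulRightL ℝ (Fin n → ℝ) A
        (ContinuousLinearMap.proj (R := ℝ) (φ := fun _ : Fin n => ℝ) j)).differentiableAt.comp y
        (differentiableAt_pi.1 hω j)
  have hsum : HasFDerivAt (fun z => formOfComponents ω z v)
      (∑ j, v j • fderiv ℝ (fun z => ω z j) y) y := by
    simp only [formOfComponents_apply]
    exact HasFDerivAt.fun_sum fun j _ =>
      (differentiableAt_pi.1 hω j).hasFDerivAt.const_smul (v j)
  have happ := hW.hasFDerivAt.clm_apply (hasFDerivAt_const v y)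
  have := DFunLike.congr_fun (happ.unique hsum) u
  simp only [add_apply, ContinuousLinearMap.flip_apply, ContinuousLinearMap.comp_apply,
    zero_apply, map_zero, zero_add, sum_apply, smul_apply] at this
  rw [this, Finset.sum_comm]
  refine Finset.sum_congr rfl fun j _ => ?_
  conv_lhs => rw [pi_eq_sum_univ' u]
  simp only [map_sum, map_smul, Finset.smul_sum, smul_smul]
  exact Finset.sum_congr rfl fun i _ => by rw [mul_comm]

/-- The Maurer–Cartan equation in components implies its invariant form. -/
lemma flat_formOfComponents (hω : DifferentiableAt ℝ ω y)
    (hMC : ∀ i j : Fin n, fderiv ℝ (fun z => ω z j) y (Pi.single i 1)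
        - fderiv ℝ (fun z => ω z i) y (Pi.single j 1)
        + ω y i * ω y j - ω y j * ω y i = 0) (u v : Fin n → ℝ) :
    fderiv ℝ (formOfComponents ω) y u v - fderiv ℝ (formOfComponents ω) y v u
      + formOfComponents ω y u * formOfComponents ω y v
      - formOfComponents ω y v * formOfComponents ω y u = 0 := by
  have hmul : ∀ a b : Fin n → ℝ, formOfComponents ω y a * formOfComponents ω y b
      = ∑ i, ∑ j, (a i * b j) • (ω y i * ω y j) := fun a b => by
    simp only [formOfComponents_apply, Finset.sum_mul_sum, smul_mul_smul_comm]
  rw [hmul, hmul, fderiv_formOfComponents hω, fderiv_formOfComponents hω,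
    Finset.sum_comm (f := fun i j => (v i * u j) • fderiv ℝ (fun z => ω z j) y (Pi.single i 1)),
    Finset.sum_comm (f := fun i j => (v i * u j) • (ω y i * ω y j))]
  simp only [← Finset.sum_sub_distrib, ← Finset.sum_add_distrib]
  refine Finset.sum_eq_zero fun i _ => Finset.sum_eq_zero fun j _ => ?_
  rw [mul_comm (v j), ← smul_sub, ← smul_add, ← smul_sub, hMC, smul_zero]

end Components

end FlatConnections

/-- **Flat forms pull back to gauge-equivalent forms along homotopic maps**
(1-form case).  Let `ω` be a smooth flat `A`-valued 1-form on an open `V ⊆ ℝⁿ`, and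
let `F : ℝ^m × ℝ → ℝⁿ` be a smooth homotopy with `F (x, t) ∈ V` for `t ∈ [0,1]`,
between `f₀ = F(·,0)` and `f₁ = F(·,1)`.  With pullback components
`(f*ω)_i x = Σ_j ∂_i f_j x • ω_j (f x)`, there is a smooth invertible-valued
`g : ℝ^m → A` with `(f₁*ω)_i = g·(f₀*ω)_i·g⁻¹ - ∂_i g·g⁻¹`. -/
theorem flat_pullbacks_along_homotopic_maps_gauge_equivalent
    {A : Type*} [NormedRing A] [NormedAlgebra ℝ A] [CompleteSpace A]
    {n m : ℕ} (V : Set (Fin n → ℝ)) (hV : IsOpen V)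
    (ω : (Fin n → ℝ) → Fin n → A)
    (hω : ContDiffOn ℝ (⊤ : ℕ∞) ω V)
    (hMC : ∀ i j : Fin n, ∀ x ∈ V,
      fderiv ℝ (fun y => ω y j) x (Pi.single i 1)
        - fderiv ℝ (fun y => ω y i) x (Pi.single j 1)
        + ω x i * ω x j - ω x j * ω x i = 0)
    (F : (Fin m → ℝ) × ℝ → Fin n → ℝ)
    (hF : ContDiff ℝ (⊤ : ℕ∞) F)
    (hFV : ∀ x : Fin m → ℝ, ∀ t ∈ Set.Icc (0:ℝ) 1, F (x, t) ∈ V) :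
    ∃ g : (Fin m → ℝ) → A,
      ContDiff ℝ (⊤ : ℕ∞) g ∧ (∀ x, IsUnit (g x)) ∧
      ∀ (i : Fin m) (x : Fin m → ℝ),
        (∑ j : Fin n, fderiv ℝ (fun y => F (y, 1) j) x (Pi.single i 1) • ω (F (x, 1)) j)
          = g x * (∑ j : Fin n,
              fderiv ℝ (fun y => F (y, 0) j) x (Pi.single i 1) • ω (F (x, 0)) j)
              * Ring.inverse (g x)
            - fderiv ℝ g x (Pi.single i 1) * Ring.inverse (g x) := by
  have hVt : ∀ p : (Fin m → ℝ) × ℝ, p.2 ∈ Set.Icc (0 : ℝ) 1 → F p ∈ V := fun p hp =>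
    hFV p.1 p.2 hp
  have hωt : ∀ y ∈ V, ContDiffAt ℝ (⊤ : ℕ∞) ω y := fun y hy => hω.contDiffAt (hV.mem_nhds hy)
  obtain ⟨g, hg, hunit, hderiv⟩ := exists_gauge_of_flat
    (α := fun p => (formOfComponents ω (F p)).comp (fderiv ℝ F p))
    (fun p hp => ((contDiffAt_formOfComponents (hωt _ (hVt p hp))).comp p hF.contDiffAt).clm_comp
      (hF.contDiffAt.fderiv_right (by simp)))
    (fun p hp => flat_pullback
      ((contDiffAt_formOfComponents (hωt _ (hVt p hp))).differentiableAt (by simp))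
      (hF.contDiffAt.of_le (WithTop.coe_le_coe.2 le_top))
      (flat_formOfComponents ((hωt _ (hVt p hp)).differentiableAt (by simp))
        fun i j => hMC i j _ (hVt p hp)))
  refine ⟨g, hg, hunit, fun i x => ?_⟩
  have hpull : ∀ t : ℝ, ∑ j, fderiv ℝ (fun y => F (y, t) j) x (Pi.single i 1) • ω (F (x, t)) j
      = (formOfComponents ω (F (x, t))).comp (fderiv ℝ F (x, t)) (Pi.single i 1, 0) := by
    intro t
    rw [ContinuousLinearMap.comp_apply, formOfComponents_apply]
    refine Finset.sum_congr rfl fun j _ => ?_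
    have hd : HasFDerivAt (fun y : Fin m → ℝ => F (y, t)) _ x :=
      (hF.differentiable (by simp) (x, t)).hasFDerivAt.comp x (hasFDerivAt_prodMk_left x t)
    rw [(hasFDerivAt_pi'.1 hd j).fderiv]
    rfl
  rw [hpull, hpull, hderiv, sub_mul, sub_sub_cancel,
    Ring.mul_inverse_cancel_right _ _ (hunit x)]
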